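/- Let G be a bridgeless bipartite graph that is not 2-simultaneous edge colorable, such that every bridgeless bipartite graph with fewer edges than G is 2-simultaneous edge colorable, and every bridgeless bipartite graph with the same number of edges as G and more vertices than G is 2-simultaneous edge colorable. Then G has no nontrivial edge cut of size 2, i.e., for every nonempty proper subset S of V(G) with |[S, S̄]| = 2, either S or its complement consists of a single vertex. -/

import Mathlib

open SimpleGraph

/-- A proper edge coloring of `G`: incident distinct edges receive different colors. -/
def IsProperEdgeColoring {V : Type*} (G : SimpleGraph V) (c : Sym2 V → ℕ) : Prop :=
  ∀ e₁ ∈ G.edgeSet, ∀ e₂ ∈ G.edgeSet, e₁ ≠ e₂ → (∃ v, v ∈ e₁ ∧ v ∈ e₂) → c e₁ ≠ c e₂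

/-- The set of colors appearing on the edges of `G` incident to the vertex `v`. -/
def colorsAt {V : Type*} (G : SimpleGraph V) (c : Sym2 V → ℕ) (v : V) : Set ℕ :=
  {k | ∃ e ∈ G.edgeSet, v ∈ e ∧ c e = k}

/-- A `μ`-simultaneous edge coloring of `G`: `μ` proper edge colorings such that at every
vertex the set of colors appearing on its incident edges is the same in all colorings, and
no edge gets the same color in two different colorings. -/
def IsSimultaneousEdgeColoring {V : Type*} (G : SimpleGraph V) (μ : ℕ)
    (c : Fin μ → Sym2 V → ℕ) : Prop :=
  (∀ i, IsProperEdgeColoring G (c i)) ∧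
  (∀ i j : Fin μ, ∀ v : V, colorsAt G (c i) v = colorsAt G (c j) v) ∧
  (∀ i j : Fin μ, i ≠ j → ∀ e ∈ G.edgeSet, c i e ≠ c j e)

/-- `G` admits a `μ`-simultaneous edge coloring. -/
def SimultaneousEdgeColorable {V : Type*} (G : SimpleGraph V) (μ : ℕ) : Prop :=
  ∃ c : Fin μ → Sym2 V → ℕ, IsSimultaneousEdgeColoring G μ c
/-- The edge cut determined by a vertex set `S`: all edges with one endpoint in `S`
and the other in its complement. -/
def cutEdges {V : Type*} (G : SimpleGraph V) (S : Set V) : Set (Sym2 V) :=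
  {e | e ∈ G.edgeSet ∧ ∃ a ∈ S, ∃ b ∈ Sᶜ, e = s(a, b)}

/-- `G` is `k`-edge-connected: it is connected and every edge cut has at least `k` edges. -/
def IsKEdgeConnected {V : Type*} (G : SimpleGraph V) (k : ℕ) : Prop :=
  G.Connected ∧ ∀ S : Set V, S.Nonempty → Sᶜ.Nonempty → k ≤ (cutEdges G S).ncard

/-- At least two edges of `G` lead from `X` to its complement. -/
def HasTwoCutEdges {V : Type*} (G : SimpleGraph V) (X : Set V) : Prop :=
  ∃ a b a' b', a ∈ X ∧ b ∉ X ∧ a' ∈ X ∧ b' ∉ X ∧ G.Adj a b ∧ G.Adj a' b' ∧ (a ≠ a' ∨ b ≠ b')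

theorem two_le_ncard_cutEdges_iff {V : Type*} [Finite V] (G : SimpleGraph V) (X : Set V) :
    2 ≤ (cutEdges G X).ncard ↔ HasTwoCutEdges G X := by
  rw [Nat.succ_le_iff, Set.one_lt_ncard]
  constructor
  · rintro ⟨_, ⟨he, a, ha, b, hb, rfl⟩, _, ⟨he', a', ha', b', hb', rfl⟩, hne⟩
    refine ⟨a, b, a', b', ha, hb, ha', hb', he, he', ?_⟩
    by_contra! h
    exact hne (by rw [h.1, h.2])
  · rintro ⟨a, b, a', b', ha, hb, ha', hb', he, he', hne⟩
    refine ⟨s(a, b), ⟨he, a, ha, b, hb, rfl⟩, s(a', b'), ⟨he', a', ha', b', hb', rfl⟩, ?_⟩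
    intro h
    rcases Sym2.eq_iff.1 h with ⟨rfl, rfl⟩ | ⟨rfl, rfl⟩
    · simp at hne
    · exact hb' ha

theorem IsKEdgeConnected.hasTwoCutEdges {V : Type*} [Finite V] {G : SimpleGraph V}
    (h : IsKEdgeConnected G 2) {X : Set V} (hX : X.Nonempty) (hXc : Xᶜ.Nonempty) :
    HasTwoCutEdges G X :=
  (two_le_ncard_cutEdges_iff G X).1 (h.2 X hX hXc)

theorem isKEdgeConnected_two_of_hasTwoCutEdges {V : Type*} [Finite V] [Nonempty V]
    {G : SimpleGraph V}
    (h : ∀ X : Set V, X.Nonempty → Xᶜ.Nonempty → HasTwoCutEdges G X) :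
    IsKEdgeConnected G 2 := by
  refine ⟨(connected_iff _).2 ⟨fun u v => ?_, inferInstance⟩, fun X hX hXc =>
    (two_le_ncard_cutEdges_iff G X).2 (h X hX hXc)⟩
  by_contra hv
  obtain ⟨a, b, -, -, ha, hb, -, -, hab, -⟩ :=
    h {w | G.Reachable u w} ⟨u, Reachable.refl u⟩ ⟨v, hv⟩
  exact hb (Reachable.trans ha hab.reachable)

/-- The requirements that a pair of simultaneous colorings imposes at one vertex: `N` is the set
of its neighbors, and `p w`, `q w` are the colors of the edge to `w` in the two colorings. -/
def IsSimultaneousAt {V : Type*} (N : Set V) (p q : V → ℕ) : Prop :=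
  Set.InjOn p N ∧ Set.InjOn q N ∧ p '' N = q '' N ∧ ∀ w ∈ N, p w ≠ q w

namespace IsSimultaneousAt

variable {V W : Type*} {N : Set V} {p q p' q' : V → ℕ}

theorem congr (h : IsSimultaneousAt N p q) (hp : ∀ w ∈ N, p' w = p w)
    (hq : ∀ w ∈ N, q' w = q w) : IsSimultaneousAt N p' q' := by
  obtain ⟨h1, h2, h3, h4⟩ := h
  refine ⟨h1.congr fun w hw => (hp w hw).symm, h2.congr fun w hw => (hq w hw).symm, ?_, ?_⟩
  · rw [Set.image_congr hp, Set.image_congr hq, h3]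
  · intro w hw
    rw [hp w hw, hq w hw]
    exact h4 w hw

theorem comp {N : Set W} {r : W → V} (h : IsSimultaneousAt (r '' N) p q) (hr : Set.InjOn r N) :
    IsSimultaneousAt N (fun w => p (r w)) (fun w => q (r w)) := by
  obtain ⟨h1, h2, h3, h4⟩ := h
  refine ⟨h1.comp hr (Set.mapsTo_image r N), h2.comp hr (Set.mapsTo_image r N), ?_, ?_⟩
  · simpa only [Set.image_image] using h3
  · exact fun w hw => h4 _ (Set.mem_image_of_mem r hw)

theorem map (h : IsSimultaneousAt N p q) {σ : ℕ → ℕ} (hσ : σ.Injective) :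
    IsSimultaneousAt N (fun w => σ (p w)) (fun w => σ (q w)) := by
  obtain ⟨h1, h2, h3, h4⟩ := h
  refine ⟨hσ.comp_injOn h1, hσ.comp_injOn h2, ?_, fun w hw => hσ.ne (h4 w hw)⟩
  rw [← Set.image_image σ p, ← Set.image_image σ q, h3]

/-- Two new neighbors may be joined by edges whose color pairs are `(z, z')` and `(z', z)`. -/
theorem insert_insert {N' : Set V} (h : IsSimultaneousAt N p q) {w w' : V} {z z' : ℕ}
    (hN' : N' = insert w (insert w' N)) (hp : p' w = z ∧ p' w' = z') (hq : q' w = z' ∧ q' w' = z)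
    (hpN : ∀ v ∈ N, p' v = p v) (hqN : ∀ v ∈ N, q' v = q v) (hzz' : z ≠ z')
    (hz : ∀ v, p v ≠ z ∧ q v ≠ z) (hz' : ∀ v, p v ≠ z' ∧ q v ≠ z') :
    IsSimultaneousAt N' p' q' := by
  obtain ⟨h1, h2, h3, h4⟩ := h
  subst hN'
  refine ⟨?_, ?_, ?_, ?_⟩
  · intro a ha b hb hab
    have := @h1 a
    grind
  · intro a ha b hb hab
    have := @h2 a
    grind
  · rw [Set.image_insert_eq, Set.image_insert_eq, Set.image_insert_eq, Set.image_insert_eq,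
      Set.image_congr hpN, Set.image_congr hqN, h3, hp.1, hp.2, hq.1, hq.2, Set.insert_comm]
  · intro v hv
    grind

/-- A neighbor `w'` may be added by recoloring the edge to the neighbor `w`: its color pair `(x, y)`
becomes `(x, z)`, and the edge to `w'` gets `(z, y)`. -/
theorem insert_swap {N' : Set V} (h : IsSimultaneousAt N p q) {w w' : V} {z : ℕ} (hw : w ∈ N)
    (hN' : N' = insert w' N) (hp : p' w' = z) (hq : q' w = z ∧ q' w' = q w)
    (hpN : ∀ v ∈ N, p' v = p v) (hqN : ∀ v ∈ N, v ≠ w → q' v = q v)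
    (hz : ∀ v, p v ≠ z ∧ q v ≠ z) :
    IsSimultaneousAt N' p' q' := by
  obtain ⟨h1, h2, h3, h4⟩ := h
  subst hN'
  refine ⟨?_, ?_, ?_, ?_⟩
  · intro a ha b hb hab
    have := @h1 a
    grind
  · intro a ha b hb hab
    by_cases haw : a = w <;> by_cases hbw : b = w <;> have := @h2 a <;> have := @h2 w hw <;> grind
  · have e : q' '' N = insert z (q '' (N \ {w})) := by
      rw [← Set.insert_sdiff_self_of_mem hw, Set.image_insert_eq, hq.1]
      congr 1
      simp only [Set.insert_sdiff_self_of_mem hw]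
      exact Set.image_congr fun v hv => hqN v hv.1 hv.2
    rw [Set.image_insert_eq, Set.image_insert_eq, Set.image_congr hpN, h3, e, hp, hq.2,
      Set.insert_comm, ← Set.image_insert_eq, Set.insert_sdiff_self_of_mem hw]
  · intro v hv
    grind

end IsSimultaneousAt

/-- A pair of simultaneous colorings of the edges of `G` that meet `S`, with the requirements
imposed at the vertices of `S` only. -/
def IsSimultaneousOn {V : Type*} (G : SimpleGraph V) (S : Set V) (f g : V → V → ℕ) : Prop :=
  (∀ u ∈ S, ∀ v ∈ S, G.Adj u v → f u v = f v u ∧ g u v = g v u) ∧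
  ∀ u ∈ S, IsSimultaneousAt (G.neighborSet u) (f u) (g u)

theorem IsSimultaneousOn.map {V : Type*} {G : SimpleGraph V} {S : Set V} {f g : V → V → ℕ}
    (h : IsSimultaneousOn G S f g) {σ : ℕ → ℕ} (hσ : σ.Injective) :
    IsSimultaneousOn G S (fun u v => σ (f u v)) (fun u v => σ (g u v)) := by
  refine ⟨fun u hu v hv huv => ?_, fun u hu => (h.2 u hu).map hσ⟩
  simp only [(h.1 u hu v hv huv).1, (h.1 u hu v hv huv).2, and_self]

theorem colorsAt_eq_image {V : Type*} (G : SimpleGraph V) (c : Sym2 V → ℕ) (v : V) :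
    colorsAt G c v = (fun w => c s(v, w)) '' G.neighborSet v := by
  ext k
  constructor
  · rintro ⟨e, he, hv, rfl⟩
    obtain ⟨w, rfl⟩ := Sym2.mem_iff_exists.1 hv
    exact ⟨w, he, rfl⟩
  · rintro ⟨w, hw, rfl⟩
    exact ⟨s(v, w), hw, Sym2.mem_mk_left v w, rfl⟩

theorem isProperEdgeColoring_iff_injOn {V : Type*} (G : SimpleGraph V) (c : Sym2 V → ℕ) :
    IsProperEdgeColoring G c ↔ ∀ v, Set.InjOn (fun w => c s(v, w)) (G.neighborSet v) := by
  constructor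
  · intro h v w hw w' hw' hc
    by_contra hne
    exact h s(v, w) hw s(v, w') hw' (fun e => hne (Sym2.congr_right.1 e))
      ⟨v, Sym2.mem_mk_left v w, Sym2.mem_mk_left v w'⟩ hc
  · rintro h e he e' he' hne ⟨v, hv, hv'⟩ hc
    obtain ⟨w, rfl⟩ := Sym2.mem_iff_exists.1 hv
    obtain ⟨w', rfl⟩ := Sym2.mem_iff_exists.1 hv'
    exact hne (congrArg (fun x => s(v, x)) (h v he he' hc))

theorem simultaneousEdgeColorable_two_iff {V : Type*} (G : SimpleGraph V) :
    SimultaneousEdgeColorable G 2 ↔ ∃ f g, IsSimultaneousOn G Set.univ f g := by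
  classical
  constructor
  · rintro ⟨c, h1, h2, h3⟩
    refine ⟨fun u v => c 0 s(u, v), fun u v => c 1 s(u, v), ?_, ?_⟩
    · intro u _ v _ _
      exact ⟨congrArg (c 0) Sym2.eq_swap, congrArg (c 1) Sym2.eq_swap⟩
    · intro u _
      refine ⟨(isProperEdgeColoring_iff_injOn _ _).1 (h1 0) u,
        (isProperEdgeColoring_iff_injOn _ _).1 (h1 1) u, ?_,
        fun w hw => h3 0 1 (by decide) s(u, w) hw⟩
      simpa only [colorsAt_eq_image] using h2 0 1 u
  · rintro ⟨f, g, hs, hl⟩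
    have lift : ∀ f : V → V → ℕ, (∀ u v, G.Adj u v → f u v = f v u) →
        ∃ c : Sym2 V → ℕ, ∀ u v, G.Adj u v → c s(u, v) = f u v := by
      intro f hf
      refine ⟨Sym2.lift ⟨fun u v => if G.Adj u v then f u v else 0, fun u v => ?_⟩, ?_⟩
      · by_cases h : G.Adj u v
        · simp [h, h.symm, hf u v h]
        · simp [h, mt G.adj_symm h]
      · intro u v h
        simp [h]
    obtain ⟨c, hc⟩ := lift f fun u v h => (hs u trivial v trivial h).1
    obtain ⟨d, hd⟩ := lift g fun u v h => (hs u trivial v trivial h).2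
    have key : ∀ v, IsSimultaneousAt (G.neighborSet v) (fun w => c s(v, w)) (fun w => d s(v, w)) :=
      fun v => (hl v trivial).congr (fun w hw => hc v w hw) (fun w hw => hd v w hw)
    refine ⟨![c, d], ?_, ?_, ?_⟩
    · simp only [Fin.forall_fin_two, isProperEdgeColoring_iff_injOn]
      exact ⟨fun v => (key v).1, fun v => (key v).2.1⟩
    · have e : ∀ v, colorsAt G c v = colorsAt G d v := fun v => by
        simpa only [colorsAt_eq_image] using (key v).2.2.1
      simp [Fin.forall_fin_two, e]
    · have e : ∀ e ∈ G.edgeSet, c e ≠ d e := by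
        intro e
        induction e using Sym2.ind with
        | _ u v => exact fun h => (key u).2.2.2 v h
      simp only [Fin.forall_fin_two]
      simpa using ⟨e, fun x hx => (e x hx).symm⟩

/-- Every bridgeless bipartite graph with fewer than `m` edges has a simultaneous coloring. -/
def SimultaneousColorableBelow (m : ℕ) : Prop :=
  ∀ (k : ℕ) (G : SimpleGraph (Fin k)), IsKEdgeConnected G 2 → G.Colorable 2 →
    G.edgeSet.ncard < m → SimultaneousEdgeColorable G 2

/-- The graph `H` may have isolated vertices outside `T`. -/
theorem SimultaneousColorableBelow.exists_of_support {m : ℕ} (hm : SimultaneousColorableBelow m)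
    {V : Type*} [Finite V] {H : SimpleGraph V} {T : Set V} (hT : T.Nonempty)
    (hHT : ∀ u v, H.Adj u v → u ∈ T)
    (hcut : ∀ X : Set V, (∃ x ∈ T, x ∈ X) → (∃ x ∈ T, x ∉ X) → HasTwoCutEdges H X)
    (hbip : H.Colorable 2) (hcard : H.edgeSet.ncard < m) :
    ∃ f g, IsSimultaneousOn H Set.univ f g := by
  obtain ⟨k, ⟨e⟩⟩ := Finite.exists_equiv_fin T
  set j : Fin k → V := fun i => (e.symm i : V) with hj
  have jinj : j.Injective := Subtype.val_injective.comp e.symm.injective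
  have jmem : ∀ i, j i ∈ T := fun i => (e.symm i).2
  have jsurj : ∀ t ∈ T, ∃ i, j i = t := fun t ht => ⟨e ⟨t, ht⟩, by simp [hj]⟩
  obtain ⟨t₀, ht₀⟩ := hT
  have : Nonempty (Fin k) := ⟨e ⟨t₀, ht₀⟩⟩
  have hconn : IsKEdgeConnected (H.comap j) 2 := by
    refine isKEdgeConnected_two_of_hasTwoCutEdges fun X ⟨x, hx⟩ ⟨y, hy⟩ => ?_
    obtain ⟨a, b, a', b', ha, hb, ha', hb', h, h', hne⟩ := hcut (j '' X)
      ⟨j x, jmem x, Set.mem_image_of_mem j hx⟩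
      ⟨j y, jmem y, fun h => hy (jinj.mem_set_image.1 h)⟩
    obtain ⟨b, rfl⟩ := jsurj b (hHT _ _ h.symm)
    obtain ⟨b', rfl⟩ := jsurj b' (hHT _ _ h'.symm)
    obtain ⟨a, ha, rfl⟩ := ha
    obtain ⟨a', ha', rfl⟩ := ha'
    exact ⟨a, b, a', b', ha, fun hb' => hb (Set.mem_image_of_mem j hb'), ha',
      fun hb => hb' (Set.mem_image_of_mem j hb), h, h',
      hne.imp (fun h e => h (congrArg j e)) (fun h e => h (congrArg j e))⟩
  have hle : (H.comap j).edgeSet.ncard ≤ H.edgeSet.ncard := by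
    refine Set.ncard_le_ncard_of_injOn (Sym2.map j) ?_ (Sym2.map.injective jinj).injOn
    intro e
    induction e using Sym2.ind with
    | _ u v => exact id
  have hcol : (H.comap j).Colorable 2 :=
    hbip.of_hom (Hom.comap j H)
  obtain ⟨f, g, hs, hl⟩ :=
    (simultaneousEdgeColorable_two_iff _).1 (hm k _ hconn hcol (hle.trans_lt hcard))
  set r := Function.invFun j
  have hr : ∀ i, r (j i) = i := Function.leftInverse_invFun jinj
  refine ⟨fun u v => f (r u) (r v), fun u v => g (r u) (r v), fun u _ v _ huv => ?_, fun u _ => ?_⟩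
  · obtain ⟨u, rfl⟩ := jsurj u (hHT _ _ huv)
    obtain ⟨v, rfl⟩ := jsurj v (hHT _ _ huv.symm)
    simpa only [hr] using hs u trivial v trivial huv
  · by_cases hu : u ∈ T
    · obtain ⟨u, rfl⟩ := jsurj u hu
      have himg : r '' H.neighborSet (j u) = (H.comap j).neighborSet u := by
        ext w
        constructor
        · rintro ⟨v, hv, rfl⟩
          obtain ⟨v, rfl⟩ := jsurj v (hHT _ _ (H.adj_symm hv))
          rw [hr]
          exact hv
        · exact fun hw => ⟨j w, hw, hr w⟩
      refine IsSimultaneousAt.comp (p := f (r (j u))) (q := g (r (j u))) ?_ ?_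
      · rw [himg, hr]
        exact hl u trivial
      · intro v hv w hw hvw
        obtain ⟨v, rfl⟩ := jsurj v (hHT _ _ (H.adj_symm hv))
        obtain ⟨w, rfl⟩ := jsurj w (hHT _ _ (H.adj_symm hw))
        rw [hr, hr] at hvw
        rw [hvw]
    · have : H.neighborSet u = ∅ := Set.eq_empty_of_forall_notMem fun v hv => hu (hHT u v hv)
      rw [this]
      exact ⟨Set.injOn_empty _, Set.injOn_empty _, by simp, by simp⟩

section Map

variable {V : Type*} {G : SimpleGraph V} {π : V → V}

theorem ncard_edgeSet_map_lt [Finite V] {u v : V} (huv : G.Adj u v) (hπ : π u = π v) :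
    (G.map π).edgeSet.ncard < G.edgeSet.ncard := by
  have hsub : (G.map π).edgeSet ⊆ Sym2.map π '' (G.edgeSet \ {s(u, v)}) := by
    intro e
    induction e using Sym2.ind with
    | _ x y =>
      rintro ⟨hne, u', v', h, rfl, rfl⟩
      refine ⟨s(u', v'), ⟨h, fun he => hne ?_⟩, rfl⟩
      rcases Sym2.eq_iff.1 he with ⟨rfl, rfl⟩ | ⟨rfl, rfl⟩
      exacts [hπ, hπ.symm]
  calc _ ≤ _ := Set.ncard_le_ncard hsub
    _ ≤ _ := Set.ncard_image_le
    _ < _ := Set.ncard_sdiff_singleton_lt_of_mem huv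

theorem hasTwoCutEdges_map
    (hG : ∀ X : Set V, X.Nonempty → Xᶜ.Nonempty → HasTwoCutEdges G X)
    (hπ : ∀ u v u' v', G.Adj u v → G.Adj u' v' → π u ≠ π v → π u = π u' → π v = π v' →
      u = u' ∧ v = v')
    {X : Set V} (hX : ∃ x, π x ∈ X) (hXc : ∃ x, π x ∉ X) : HasTwoCutEdges (G.map π) X := by
  obtain ⟨a, b, a', b', ha, hb, ha', hb', h, h', hne⟩ := hG (π ⁻¹' X) hX hXc
  have hab : π a ≠ π b := fun e => hb (show π b ∈ X from e ▸ ha)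
  have hab' : π a' ≠ π b' := fun e => hb' (show π b' ∈ X from e ▸ ha')
  refine ⟨π a, π b, π a', π b', ha, hb, ha', hb', ⟨hab, a, b, h, rfl, rfl⟩,
    ⟨hab', a', b', h', rfl, rfl⟩, ?_⟩
  by_contra! hcon
  obtain ⟨rfl, rfl⟩ := hπ a b a' b' h h' hab hcon.1 hcon.2
  simp at hne

theorem SimultaneousColorableBelow.exists_map [Finite V]
    (hm : SimultaneousColorableBelow G.edgeSet.ncard) (χ : V → Fin 2)
    (hχ : ∀ u v, (G.map π).Adj u v → χ u ≠ χ v)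
    (hcut : ∀ X : Set V, (∃ x, π x ∈ X) → (∃ x, π x ∉ X) → HasTwoCutEdges (G.map π) X)
    {u v : V} (huv : G.Adj u v) (hπ : π u = π v) :
    ∃ f g, IsSimultaneousOn (G.map π) Set.univ f g := by
  refine hm.exists_of_support (T := Set.range π) ⟨π u, u, rfl⟩ ?_ ?_
    ⟨Coloring.mk χ fun {u v} h => hχ u v h⟩ (ncard_edgeSet_map_lt huv hπ)
  · rintro _ _ ⟨-, u, -, -, rfl, -⟩
    exact ⟨u, rfl⟩
  · rintro X ⟨_, ⟨x, rfl⟩, hx⟩ ⟨_, ⟨y, rfl⟩, hy⟩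
    exact hcut X ⟨x, hx⟩ ⟨y, hy⟩

end Map

open Classical in
/-- Identify all vertices outside `S` with `p`. -/
noncomputable def collapseCompl {V : Type*} (S : Set V) (p v : V) : V := if v ∈ S then v else p

section Collapse

variable {V : Type*} {S : Set V} {p v : V}

theorem collapseCompl_of_mem (h : v ∈ S) : collapseCompl S p v = v := if_pos h

theorem collapseCompl_of_notMem (h : v ∉ S) : collapseCompl S p v = p := if_neg h

end Collapse

/-- If all edges leaving `T` start in `a`, then the graph inside `T` has a simultaneous coloring. -/
theorem SimultaneousColorableBelow.exists_inside {V : Type*} [Finite V] {G : SimpleGraph V}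
    (hm : SimultaneousColorableBelow G.edgeSet.ncard)
    (hG : ∀ X : Set V, X.Nonempty → Xᶜ.Nonempty → HasTwoCutEdges G X)
    {χ : V → Fin 2} (hχ : ∀ u v, G.Adj u v → χ u ≠ χ v) {T : Set V} {a b : V}
    (ha : a ∈ T) (hb : b ∉ T) (hab : G.Adj a b)
    (hT : ∀ u ∈ T, ∀ v ∉ T, G.Adj u v → u = a) :
    ∃ f g : V → V → ℕ, (∀ u ∈ T, ∀ v ∈ T, G.Adj u v → f u v = f v u ∧ g u v = g v u) ∧
      ∀ u ∈ T, IsSimultaneousAt (G.neighborSet u ∩ T) (f u) (g u) := by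
  have hmem : ∀ u v, G.Adj u v → collapseCompl T a u ≠ collapseCompl T a v → u ∈ T ∧ v ∈ T := by
    intro u v huv hne
    by_cases hu : u ∈ T <;> by_cases hv : v ∈ T
    · exact ⟨hu, hv⟩
    · exact absurd (by rw [collapseCompl_of_mem hu, collapseCompl_of_notMem hv,
        hT u hu v hv huv]) hne
    · exact absurd (by rw [collapseCompl_of_mem hv, collapseCompl_of_notMem hu,
        hT v hv u hu huv.symm]) hne
    · exact absurd (by rw [collapseCompl_of_notMem hv, collapseCompl_of_notMem hu]) hne
  have hadj : ∀ u v, (G.map (collapseCompl T a)).Adj u v ↔ u ∈ T ∧ v ∈ T ∧ G.Adj u v := by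
    intro u v
    constructor
    · rintro ⟨hne, u, v, huv, rfl, rfl⟩
      obtain ⟨hu, hv⟩ := hmem u v huv hne
      rw [collapseCompl_of_mem hu, collapseCompl_of_mem hv]
      exact ⟨hu, hv, huv⟩
    · rintro ⟨hu, hv, huv⟩
      exact ⟨huv.ne, u, v, huv, collapseCompl_of_mem hu, collapseCompl_of_mem hv⟩
  obtain ⟨f, g, hs, hl⟩ := hm.exists_map (π := collapseCompl T a) χ
    (fun u v h => hχ u v ((hadj u v).1 h).2.2)
    (fun X => hasTwoCutEdges_map hG fun u v u' v' huv huv' hne hu hv => by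
      have h := hmem u v huv hne
      have h' := hmem u' v' huv' (hu ▸ hv ▸ hne)
      rw [collapseCompl_of_mem h.1, collapseCompl_of_mem h'.1] at hu
      rw [collapseCompl_of_mem h.2, collapseCompl_of_mem h'.2] at hv
      exact ⟨hu, hv⟩)
    hab (by rw [collapseCompl_of_mem ha, collapseCompl_of_notMem hb])
  refine ⟨f, g, fun u hu v hv huv => hs u trivial v trivial ((hadj u v).2 ⟨hu, hv, huv⟩),
    fun u hu => ?_⟩
  convert hl u trivial using 1
  ext v
  simp only [Set.mem_inter_iff, mem_neighborSet, hadj]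
  tauto

/-- The edges between `S` and its complement are `a b` and `a' b'`. -/
structure IsTwoEdgeCut {V : Type*} (G : SimpleGraph V) (S : Set V) (a b a' b' : V) : Prop where
  left_mem : a ∈ S
  right_notMem : b ∉ S
  left_mem' : a' ∈ S
  right_notMem' : b' ∉ S
  adj : G.Adj a b
  adj' : G.Adj a' b'
  ne : a ≠ a' ∨ b ≠ b'
  eq_or_eq : ∀ u ∈ S, ∀ v ∉ S, G.Adj u v → u = a ∧ v = b ∨ u = a' ∧ v = b'

theorem exists_isTwoEdgeCut {V : Type*} {G : SimpleGraph V} {S : Set V}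
    (h : (cutEdges G S).ncard = 2) : ∃ a b a' b', IsTwoEdgeCut G S a b a' b' := by
  obtain ⟨e, e', hne, heq⟩ := Set.ncard_eq_two.1 h
  obtain ⟨he, a, ha, b, hb, rfl⟩ : e ∈ cutEdges G S := by simp [heq]
  obtain ⟨he', a', ha', b', hb', rfl⟩ : e' ∈ cutEdges G S := by simp [heq]
  refine ⟨a, b, a', b', ha, hb, ha', hb', he, he', ?_, fun u hu v hv huv => ?_⟩
  · by_contra! hcon
    exact hne (by rw [hcon.1, hcon.2])
  · have huv : s(u, v) ∈ cutEdges G S := ⟨huv, u, hu, v, hv, rfl⟩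
    simp only [heq, Set.mem_insert_iff, Set.mem_singleton_iff, Sym2.eq_iff] at huv
    grind

namespace IsTwoEdgeCut

variable {V : Type*} {G : SimpleGraph V} {S : Set V} {a b a' b' : V}

theorem compl (h : IsTwoEdgeCut G S a b a' b') : IsTwoEdgeCut G Sᶜ b a b' a' where
  left_mem := h.right_notMem
  right_notMem := not_not.2 h.left_mem
  left_mem' := h.right_notMem'
  right_notMem' := not_not.2 h.left_mem'
  adj := h.adj.symm
  adj' := h.adj'.symm
  ne := h.ne.symm
  eq_or_eq u hu v hv huv := by
    have := h.eq_or_eq v (not_not.1 hv) u hu huv.symm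
    tauto

theorem map_collapseCompl_adj (h : IsTwoEdgeCut G S a b a' b') (p u v : V) :
    (G.map (collapseCompl S p)).Adj u v ↔ u ≠ v ∧ (u ∈ S ∧ v ∈ S ∧ G.Adj u v ∨
      u = a ∧ v = p ∨ u = p ∧ v = a ∨ u = a' ∧ v = p ∨ u = p ∧ v = a') := by
  constructor
  · rintro ⟨hne, u, v, huv, rfl, rfl⟩
    refine ⟨hne, ?_⟩
    by_cases hu : u ∈ S <;> by_cases hv : v ∈ S
    · rw [collapseCompl_of_mem hu, collapseCompl_of_mem hv]
      exact Or.inl ⟨hu, hv, huv⟩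
    · have := h.eq_or_eq u hu v hv huv
      rw [collapseCompl_of_mem hu, collapseCompl_of_notMem hv]
      tauto
    · have := h.eq_or_eq v hv u hu huv.symm
      rw [collapseCompl_of_mem hv, collapseCompl_of_notMem hu]
      tauto
    · exact absurd (by rw [collapseCompl_of_notMem hv, collapseCompl_of_notMem hu]) hne
  · rintro ⟨hne, ⟨hu, hv, huv⟩ | ⟨rfl, rfl⟩ | ⟨rfl, rfl⟩ | ⟨rfl, rfl⟩ | ⟨rfl, rfl⟩⟩
    · exact ⟨hne, u, v, huv, collapseCompl_of_mem hu, collapseCompl_of_mem hv⟩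
    · exact ⟨hne, u, b, h.adj,
        collapseCompl_of_mem h.left_mem, collapseCompl_of_notMem h.right_notMem⟩
    · exact ⟨hne, b, v, h.adj.symm,
        collapseCompl_of_notMem h.right_notMem, collapseCompl_of_mem h.left_mem⟩
    · exact ⟨hne, u, b', h.adj',
        collapseCompl_of_mem h.left_mem', collapseCompl_of_notMem h.right_notMem'⟩
    · exact ⟨hne, b', v, h.adj'.symm, collapseCompl_of_notMem h.right_notMem',
        collapseCompl_of_mem h.left_mem'⟩

/-- If `S` contains a vertex other than `a`, then it spans an edge. -/
theorem exists_adj_inside (h : IsTwoEdgeCut G S a b a' b')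
    (hG : ∀ X : Set V, X.Nonempty → Xᶜ.Nonempty → HasTwoCutEdges G X) (hS : S ≠ {a}) :
    ∃ u ∈ S, ∃ v ∈ S, G.Adj u v := by
  have hne : (S \ {a}).Nonempty := by
    by_contra hcon
    rw [Set.not_nonempty_iff_eq_empty, Set.sdiff_eq_empty] at hcon
    exact hS (hcon.antisymm (Set.singleton_subset_iff.2 h.left_mem))
  obtain ⟨u, v, u', v', hu, hv, hu', hv', huv, huv', hd⟩ := hG (S \ {a}) hne ⟨a, by simp⟩
  by_contra! hcon
  have h1 := h.eq_or_eq u hu.1 v (fun hv => hcon u hu.1 v hv huv) huv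
  have h2 := h.eq_or_eq u' hu'.1 v' (fun hv => hcon u' hu'.1 v' hv huv') huv'
  have h3 : u ≠ a := hu.2
  have h4 : u' ≠ a := hu'.2
  grind

theorem exists_glue (h : IsTwoEdgeCut G S a b a' b') {f g f' g' : V → V → ℕ}
    (hS : IsSimultaneousOn G S f g) (hSc : IsSimultaneousOn G Sᶜ f' g')
    (hf : f a b = f' b a ∧ f a' b' = f' b' a') (hg : g a b = g' b a ∧ g a' b' = g' b' a') :
    ∃ f g, IsSimultaneousOn G Set.univ f g := by
  classical
  refine ⟨fun u => if u ∈ S then f u else f' u, fun u => if u ∈ S then g u else g' u,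
    fun u _ v _ huv => ?_, fun u _ => ?_⟩
  · by_cases hu : u ∈ S <;> by_cases hv : v ∈ S
    · simpa only [hu, hv, if_true] using hS.1 u hu v hv huv
    · simp only [hu, hv, if_true, if_false]
      rcases h.eq_or_eq u hu v hv huv with ⟨rfl, rfl⟩ | ⟨rfl, rfl⟩
      exacts [⟨hf.1, hg.1⟩, ⟨hf.2, hg.2⟩]
    · simp only [hu, hv, if_true, if_false]
      rcases h.eq_or_eq v hv u hu huv.symm with ⟨rfl, rfl⟩ | ⟨rfl, rfl⟩
      exacts [⟨hf.1.symm, hg.1.symm⟩, ⟨hf.2.symm, hg.2.symm⟩]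
    · simpa only [hu, hv, if_false] using hSc.1 u hu v hv huv
  · by_cases hu : u ∈ S
    · simpa only [hu, if_true] using hS.2 u hu
    · simpa only [hu, if_false] using hSc.2 u hu

/-- Permuting colors makes two partial colorings agree on the edge `a b`. -/
theorem exists_glue_of_perm (h : IsTwoEdgeCut G S a b a' b') {f g f' g' : V → V → ℕ}
    (hS : IsSimultaneousOn G S f g) (hSc : IsSimultaneousOn G Sᶜ f' g')
    (hcompat : f a' b' = f a b ∧ g a' b' = g a b ∧ f' b' a' = f' b a ∧ g' b' a' = g' b a ∨
      f a' b' = g a b ∧ g a' b' = f a b ∧ f' b' a' = g' b a ∧ g' b' a' = f' b a) :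
    ∃ f g, IsSimultaneousOn G Set.univ f g := by
  have hz : f a b ≠ g a b := (hS.2 a h.left_mem).2.2.2 b h.adj
  have hw : f' b a ≠ g' b a := (hSc.2 b h.right_notMem).2.2.2 a h.adj.symm
  obtain ⟨σ, hσ, h1, h2⟩ : ∃ σ : ℕ → ℕ, σ.Injective ∧ σ (f' b a) = f a b ∧ σ (g' b a) = g a b := by
    refine ⟨Equiv.swap (Equiv.swap (f' b a) (f a b) (g' b a)) (g a b) ∘
      Equiv.swap (f' b a) (f a b), (Equiv.injective _).comp (Equiv.injective _), ?_, ?_⟩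
    · rw [Function.comp_apply, Equiv.swap_apply_left, Equiv.swap_apply_of_ne_of_ne _ hz]
      intro he
      have : Equiv.swap (f' b a) (f a b) (f' b a) = Equiv.swap (f' b a) (f a b) (g' b a) := by
        rw [Equiv.swap_apply_left, ← he]
      exact hw ((Equiv.injective _) this)
    · simp
  refine h.exists_glue hS (hSc.map hσ) ?_ ?_
  · rcases hcompat with ⟨e1, e2, e3, e4⟩ | ⟨e1, e2, e3, e4⟩ <;> simp [e1, e3, h1, h2]
  · rcases hcompat with ⟨e1, e2, e3, e4⟩ | ⟨e1, e2, e3, e4⟩ <;> simp [e2, e4, h1, h2]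

end IsTwoEdgeCut

theorem exists_color_bound {V : Type*} [Finite V] (f g : V → V → ℕ) :
    ∃ M, ∀ u v, f u v < M ∧ g u v < M := by
  obtain ⟨M, hM⟩ := (Set.finite_range fun x : V × V => f x.1 x.2 + g x.1 x.2).bddAbove
  refine ⟨M + 1, fun u v => ?_⟩
  have : f u v + g u v ≤ M := hM ⟨(u, v), rfl⟩
  omega

namespace SimultaneousColorableBelow

variable {V : Type*} [Finite V] {G : SimpleGraph V} {χ : V → Fin 2}

/-- If exactly the two edges `a w`, `a w'` leave `T`, then they may receive any two swapped color
pairs of large colors. -/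
theorem exists_of_attached (hm : SimultaneousColorableBelow G.edgeSet.ncard)
    (hG : ∀ X : Set V, X.Nonempty → Xᶜ.Nonempty → HasTwoCutEdges G X)
    (hχ : ∀ u v, G.Adj u v → χ u ≠ χ v) {T : Set V} {a w w' : V}
    (ha : a ∈ T) (hw : w ∉ T) (hw' : w' ∉ T) (haw : G.Adj a w) (haw' : G.Adj a w') (hne : w ≠ w')
    (hT : ∀ u ∈ T, ∀ v ∉ T, G.Adj u v → u = a ∧ (v = w ∨ v = w')) :
    ∃ M, ∀ z z', M ≤ z → M ≤ z' → z ≠ z' → ∃ f g, IsSimultaneousOn G T f g ∧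
      f a w = z ∧ f a w' = z' ∧ g a w = z' ∧ g a w' = z := by
  classical
  obtain ⟨f, g, hs, hl⟩ :=
    hm.exists_inside hG hχ ha hw haw fun u hu v hv huv => (hT u hu v hv huv).1
  obtain ⟨M, hM⟩ := exists_color_bound f g
  refine ⟨M, fun z z' hz hz' hzz' => ⟨fun u v => if v ∈ T then f u v else if v = w then z else z',
    fun u v => if v ∈ T then g u v else if v = w then z' else z,
    ⟨fun u hu v hv huv => ?_, fun u hu => ?_⟩, ?_⟩⟩
  · simpa only [hu, hv, if_true] using hs u hu v hv huv
  · by_cases hua : u = a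
    · subst hua
      refine (hl u hu).insert_insert (w := w) (w' := w') (z := z) (z' := z') ?_ ?_ ?_ ?_ ?_ hzz'
        (fun v => ⟨((hM u v).1.trans_le hz).ne, ((hM u v).2.trans_le hz).ne⟩)
        (fun v => ⟨((hM u v).1.trans_le hz').ne, ((hM u v).2.trans_le hz').ne⟩)
      · ext v
        simp only [mem_neighborSet, Set.mem_insert_iff, Set.mem_inter_iff]
        constructor
        · intro huv
          by_cases hv : v ∈ T
          · exact Or.inr (Or.inr ⟨huv, hv⟩)
          · rcases (hT u hu v hv huv).2 with h | h <;> simp [h]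
        · rintro (rfl | rfl | h)
          exacts [haw, haw', h.1]
      · simp [hw, hw', hne.symm]
      · simp [hw, hw', hne.symm]
      · intro v hv
        simp [hv.2]
      · intro v hv
        simp [hv.2]
    · have hsub : ∀ v ∈ G.neighborSet u, v ∈ T := fun v hv => by
        by_contra hvT
        exact hua (hT u hu v hvT hv).1
      have := hl u hu
      rw [Set.inter_eq_left.2 hsub] at this
      exact this.congr (fun v hv => if_pos (hsub v hv)) (fun v hv => if_pos (hsub v hv))
  · simp [hw, hw', hne.symm]

/-- If `a` and `a'` have the same color, then the two cut edges get swapped color pairs. -/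
theorem exists_of_same_side (hm : SimultaneousColorableBelow G.edgeSet.ncard)
    (hG : ∀ X : Set V, X.Nonempty → Xᶜ.Nonempty → HasTwoCutEdges G X)
    (hχ : ∀ u v, G.Adj u v → χ u ≠ χ v) {S : Set V} {a b a' b' : V}
    (h : IsTwoEdgeCut G S a b a' b') (haa' : χ a = χ a') (hSc : Sᶜ ≠ {b}) :
    ∃ f g, IsSimultaneousOn G S f g ∧ f a' b' = g a b ∧ g a' b' = f a b := by
  by_cases heq : a = a'
  · subst heq
    obtain ⟨M, hM⟩ := hm.exists_of_attached hG hχ h.left_mem h.right_notMem h.right_notMem' h.adj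
      h.adj' (h.ne.resolve_left fun hn => hn rfl) fun u hu v hv huv => by
        have := h.eq_or_eq u hu v hv huv
        tauto
    obtain ⟨f, g, hfg, h1, h2, h3, h4⟩ := hM M (M + 1) le_rfl (by omega) (by omega)
    exact ⟨f, g, hfg, by rw [h2, h3], by rw [h4, h1]⟩
  · have hb := h.right_notMem
    have ha := h.left_mem
    have ha' := h.left_mem'
    have hab : χ a ≠ χ b := hχ a b h.adj
    have hadj := h.map_collapseCompl_adj b
    obtain ⟨u, hu, v, hv, huv⟩ := h.compl.exists_adj_inside hG hSc
    obtain ⟨f, g, hs, hl⟩ := hm.exists_map (π := collapseCompl S b) χ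
      (fun u v huv => by
        rcases (hadj u v).1 huv with ⟨hne, h | h⟩
        · exact hχ u v h.2.2
        · grind)
      (fun X => hasTwoCutEdges_map hG fun u v u' v' huv huv' hne hu hv => by
        have e1 := h.eq_or_eq u
        have e2 := h.eq_or_eq u'
        have e3 := h.eq_or_eq v
        have e4 := h.eq_or_eq v'
        have := huv.symm
        have := huv'.symm
        simp only [collapseCompl] at hne hu hv
        grind)
      huv (by rw [collapseCompl_of_notMem hu, collapseCompl_of_notMem hv])
    have hN : (G.map (collapseCompl S b)).neighborSet b = {a, a'} := by
      ext v
      simp only [mem_neighborSet, hadj, Set.mem_insert_iff, Set.mem_singleton_iff]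
      grind
    have hπ : ∀ u ∈ S, Set.InjOn (collapseCompl S b) (G.neighborSet u) := by
      intro u hu v hv w hw hvw
      have e1 := h.eq_or_eq u hu v
      have e2 := h.eq_or_eq u hu w
      simp only [mem_neighborSet] at hv hw
      simp only [collapseCompl] at hvw
      grind
    have himg : ∀ u ∈ S, collapseCompl S b '' G.neighborSet u =
        (G.map (collapseCompl S b)).neighborSet u := by
      intro u hu
      ext v
      constructor
      · rintro ⟨v, hv, rfl⟩
        refine ⟨?_, u, v, hv, collapseCompl_of_mem hu, rfl⟩
        by_cases hvS : v ∈ S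
        · rw [collapseCompl_of_mem hvS]
          exact G.ne_of_adj hv
        · rw [collapseCompl_of_notMem hvS]
          exact fun e => hb (e ▸ hu)
      · rintro ⟨hne, u', v, huv, rfl, rfl⟩
        have hu' : u' ∈ S := by
          by_contra hu'
          rw [collapseCompl_of_notMem hu'] at hu
          exact hb hu
        rw [collapseCompl_of_mem hu']
        exact ⟨v, huv, rfl⟩
    refine ⟨fun u v => f u (collapseCompl S b v), fun u v => g u (collapseCompl S b v),
      ⟨fun u hu v hv huv => ?_, fun u hu => ?_⟩, ?_⟩
    · simp only [collapseCompl_of_mem hu, collapseCompl_of_mem hv]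
      exact hs u trivial v trivial ((hadj u v).2 ⟨huv.ne, Or.inl ⟨hu, hv, huv⟩⟩)
    · refine IsSimultaneousAt.comp (p := f u) (q := g u) ?_ (hπ u hu)
      rw [himg u hu]
      exact hl u trivial
    · simp only [collapseCompl_of_notMem hb, collapseCompl_of_notMem h.right_notMem']
      have hba : (G.map (collapseCompl S b)).Adj b a := (hadj b a).2 (by grind)
      have hba' : (G.map (collapseCompl S b)).Adj b a' := (hadj b a').2 (by grind)
      rw [← (hs b trivial a trivial hba).1, ← (hs b trivial a trivial hba).2,
        ← (hs b trivial a' trivial hba').1, ← (hs b trivial a' trivial hba').2]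
      obtain ⟨-, -, h3, h4⟩ := hl b trivial
      rw [hN] at h3 h4
      have k1 := h4 a (by simp)
      have k2 := h4 a' (by simp)
      have k3 : f b a ∈ g b '' {a, a'} := h3 ▸ ⟨a, by simp, rfl⟩
      have k4 : f b a' ∈ g b '' {a, a'} := h3 ▸ ⟨a', by simp, rfl⟩
      simp only [Set.mem_image, Set.mem_insert_iff, Set.mem_singleton_iff, exists_eq_or_imp,
        exists_eq_left] at k3 k4
      exact ⟨(k4.resolve_right k2.symm).symm, k3.resolve_left k1.symm⟩

/-- If `a a'` is a bridge inside `S`, then the two cut edges get equal color pairs. -/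
theorem exists_of_inner_bridge (hm : SimultaneousColorableBelow G.edgeSet.ncard)
    (hG : ∀ X : Set V, X.Nonempty → Xᶜ.Nonempty → HasTwoCutEdges G X)
    (hχ : ∀ u v, G.Adj u v → χ u ≠ χ v) {S X : Set V} {a b a' b' : V}
    (h : IsTwoEdgeCut G S a b a' b') (haa' : G.Adj a a') (ha : a ∈ X) (ha' : a' ∉ X)
    (hX : ∀ u ∈ S, ∀ v ∈ S, u ∈ X → v ∉ X → G.Adj u v → u = a ∧ v = a') :
    ∃ f g, IsSimultaneousOn G S f g ∧ f a' b' = f a b ∧ g a' b' = g a b := by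
  classical
  obtain ⟨M, hM⟩ := hm.exists_of_attached hG hχ (T := S ∩ X) (a := a) (w := a') (w' := b)
    ⟨h.left_mem, ha⟩ (fun hT => ha' hT.2) (fun hT => h.right_notMem hT.1) haa' h.adj
    (fun e => h.right_notMem (e ▸ h.left_mem')) (fun u hu v hv huv => by
      have e1 := hX u hu.1 v
      have e2 := h.eq_or_eq u hu.1 v
      have := hu.2
      grind)
  obtain ⟨M', hM'⟩ := hm.exists_of_attached hG hχ (T := S \ X) (a := a') (w := a) (w' := b')
    ⟨h.left_mem', ha'⟩ (fun hT => hT.2 ha) (fun hT => h.right_notMem' hT.1) haa'.symm h.adj'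
    (fun e => h.right_notMem' (e ▸ h.left_mem)) (fun u hu v hv huv => by
      have e1 := hX v
      have e2 := h.eq_or_eq u hu.1 v
      have := hu.2
      have := hu.1
      have := huv.symm
      grind)
  obtain ⟨f, g, hfg, h1, h2, h3, h4⟩ := hM (M + M') (M + M' + 1) (by omega) (by omega) (by omega)
  obtain ⟨f', g', hfg', h1', h2', h3', h4'⟩ :=
    hM' (M + M') (M + M' + 1) (by omega) (by omega) (by omega)
  refine ⟨fun u => if u ∈ X then f u else f' u, fun u => if u ∈ X then g u else g' u,
    ⟨fun u hu v hv huv => ?_, fun u hu => ?_⟩, ?_⟩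
  · by_cases huX : u ∈ X <;> by_cases hvX : v ∈ X
    · simpa only [huX, hvX, if_true] using hfg.1 u ⟨hu, huX⟩ v ⟨hv, hvX⟩ huv
    · obtain ⟨rfl, rfl⟩ := hX u hu v hv huX hvX huv
      simp [huX, hvX, h1, h1', h3, h3']
    · obtain ⟨rfl, rfl⟩ := hX v hv u hu hvX huX huv.symm
      simp [huX, hvX, h1, h1', h3, h3']
    · simpa only [huX, hvX, if_false] using hfg'.1 u ⟨hu, huX⟩ v ⟨hv, hvX⟩ huv
  · by_cases huX : u ∈ X
    · simpa only [huX, if_true] using hfg.2 u ⟨hu, huX⟩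
    · simpa only [huX, if_false] using hfg'.2 u ⟨hu, huX⟩
  · simp [ha, ha', h2, h2', h4, h4']

/-- If some cut of the graph inside `S` has fewer than two edges, then `a a'` is a bridge there. -/
theorem exists_of_inner_cut (hm : SimultaneousColorableBelow G.edgeSet.ncard)
    (hG : ∀ X : Set V, X.Nonempty → Xᶜ.Nonempty → HasTwoCutEdges G X)
    (hχ : ∀ u v, G.Adj u v → χ u ≠ χ v) {S X : Set V} {a b a' b' : V}
    (h : IsTwoEdgeCut G S a b a' b') (haa' : G.Adj a a') (hX : (S ∩ X).Nonempty)
    (hXc : (S \ X).Nonempty)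
    (hcut : ∀ u ∈ S, ∀ v ∈ S, ∀ u' ∈ S, ∀ v' ∈ S, u ∈ X → v ∉ X → u' ∈ X → v' ∉ X →
      G.Adj u v → G.Adj u' v' → u = u' ∧ v = v') :
    ∃ f g, IsSimultaneousOn G S f g ∧ f a' b' = f a b ∧ g a' b' = g a b := by
  have haS := h.left_mem
  have haS' := h.left_mem'
  by_cases ha : a ∈ X <;> by_cases ha' : a' ∈ X
  · obtain ⟨u, v, u', v', hu, hv, hu', hv', huv, huv', hne⟩ := hG (S \ X) hXc ⟨a, fun h => h.2 ha⟩
    have key : ∀ u ∈ S \ X, ∀ v ∉ S \ X, G.Adj u v → v ∈ S ∩ X := fun u hu v hv huv => by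
      have e1 := h.eq_or_eq u hu.1 v
      have := hu.2
      grind
    have hvS := key u hu v hv huv
    have hvS' := key u' hu' v' hv' huv'
    have := hcut v hvS.1 u hu.1 v' hvS'.1 u' hu'.1 hvS.2 hu.2 hvS'.2 hu'.2 huv.symm huv'.symm
    tauto
  · exact hm.exists_of_inner_bridge hG hχ h haa' ha ha' fun u hu v hv huX hvX huv =>
      hcut u hu v hv a haS a' haS' huX hvX ha ha' huv haa'
  · refine hm.exists_of_inner_bridge (X := Xᶜ) hG hχ h haa' ha (not_not.2 ha')
      fun u hu v hv huX hvX huv => ?_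
    exact (hcut v hv u hu a' haS' a haS (not_not.1 hvX) huX ha' ha huv.symm haa'.symm).symm
  · obtain ⟨u, v, u', v', hu, hv, hu', hv', huv, huv', hne⟩ := hG (S ∩ X) hX ⟨a, fun h => ha h.2⟩
    have key : ∀ u ∈ S ∩ X, ∀ v ∉ S ∩ X, G.Adj u v → v ∈ S \ X := fun u hu v hv huv => by
      have e1 := h.eq_or_eq u hu.1 v
      have := hu.2
      grind
    have hvS := key u hu v hv huv
    have hvS' := key u' hu' v' hv' huv'
    have := hcut u hu.1 v hvS.1 u' hu'.1 v' hvS'.1 hu.2 hvS.2 hu'.2 hvS'.2 huv huv'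
    tauto

/-- If `a` and `a'` have different colors, then the two cut edges get equal color pairs. -/
theorem exists_of_opposite_side (hm : SimultaneousColorableBelow G.edgeSet.ncard)
    (hG : ∀ X : Set V, X.Nonempty → Xᶜ.Nonempty → HasTwoCutEdges G X)
    (hχ : ∀ u v, G.Adj u v → χ u ≠ χ v) {S : Set V} {a b a' b' : V}
    (h : IsTwoEdgeCut G S a b a' b') (haa' : χ a ≠ χ a') :
    ∃ f g, IsSimultaneousOn G S f g ∧ f a' b' = f a b ∧ g a' b' = g a b := by
  classical
  have hb := h.right_notMem
  have hb' := h.right_notMem'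
  have ha := h.left_mem
  have ha' := h.left_mem'
  have hab := h.adj
  have hab' := h.adj'
  have hne : a ≠ a' := fun e => haa' (congrArg χ e)
  have hadj := h.map_collapseCompl_adj a
  by_cases hcut : ∀ X : Set V, (∃ x, collapseCompl S a x ∈ X) → (∃ x, collapseCompl S a x ∉ X) →
      HasTwoCutEdges (G.map (collapseCompl S a)) X
  · obtain ⟨f, g, hs, hl⟩ := hm.exists_map (π := collapseCompl S a) χ
      (fun u v huv => by
        rcases (hadj u v).1 huv with ⟨hne, h | h⟩
        · exact hχ u v h.2.2
        · grind)
      hcut hab (by rw [collapseCompl_of_mem ha, collapseCompl_of_notMem hb])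
    have hsS : ∀ u ∈ S, ∀ v ∈ S, G.Adj u v → f u v = f v u ∧ g u v = g v u := fun u hu v hv huv =>
      hs u trivial v trivial ((hadj u v).2 ⟨huv.ne, Or.inl ⟨hu, hv, huv⟩⟩)
    obtain ⟨hsf, hsg⟩ := hs a trivial a' trivial ((hadj a a').2 (by grind))
    by_cases hA : G.Adj a a'
    · have hA' := hA.symm
      obtain ⟨M, hM⟩ := exists_color_bound f g
      have hN : ∀ u ∈ S, (G.map (collapseCompl S a)).neighborSet u = G.neighborSet u ∩ S := by
        intro u hu
        ext v
        simp only [mem_neighborSet, hadj, Set.mem_inter_iff]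
        have := G.ne_of_adj (a := u) (b := v)
        grind
      have hz : ∀ u v, f u v ≠ M ∧ g u v ≠ M := fun u v => ⟨(hM u v).1.ne, (hM u v).2.ne⟩
      refine ⟨fun u v => if v ∈ S then f u v else M,
        fun u v => if v ∈ S then if u = a ∧ v = a' ∨ u = a' ∧ v = a then M else g u v else g a a',
        ⟨fun u hu v hv huv => ?_, fun u hu => ?_⟩, ?_⟩
      · have := hsS u hu v hv huv
        grind
      · have hlu := hl u trivial
        rw [hN u hu] at hlu
        by_cases hua : u = a
        · subst hua
          refine hlu.insert_swap (w := a') (w' := b) (z := M) ⟨hA, ha'⟩ ?_ ?_ ?_ ?_ ?_ (hz u)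
          · ext v
            have := h.eq_or_eq u hu v
            simp only [mem_neighborSet, Set.mem_insert_iff, Set.mem_inter_iff]
            grind
          all_goals grind
        · by_cases hua' : u = a'
          · subst hua'
            refine hlu.insert_swap (w := a) (w' := b') (z := M) ⟨hA', ha⟩ ?_ ?_ ?_ ?_ ?_ (hz u)
            · ext v
              have := h.eq_or_eq u hu v
              simp only [mem_neighborSet, Set.mem_insert_iff, Set.mem_inter_iff]
              grind
            all_goals grind
          · have hsub : ∀ v ∈ G.neighborSet u, v ∈ S := fun v hv => by
              by_contra hvS
              have := h.eq_or_eq u hu v hvS hv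
              tauto
            rw [Set.inter_eq_left.2 hsub] at hlu
            exact hlu.congr (fun v hv => if_pos (hsub v hv))
              (fun v hv => by simp [hsub v hv, hua, hua'])
      · simp [hb, hb']
    · have hA' : ¬ G.Adj a' a := fun e => hA e.symm
      set r : V → V → V := fun u v => if v ∈ S then v else if u = a then a' else a with hr
      have hrinj : ∀ u ∈ S, Set.InjOn (r u) (G.neighborSet u) := by
        intro u hu v hv w hw hvw
        have e1 := h.eq_or_eq u hu v
        have e2 := h.eq_or_eq u hu w
        simp only [mem_neighborSet] at hv hw
        simp only [hr] at hvw
        grind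
      have himg : ∀ u ∈ S, r u '' G.neighborSet u =
          (G.map (collapseCompl S a)).neighborSet u := by
        intro u hu
        ext v
        simp only [mem_neighborSet, hadj, Set.mem_image]
        constructor
        · rintro ⟨w, hw, rfl⟩
          have := h.eq_or_eq u hu w
          have := hw.ne
          simp only [hr]
          grind
        · rintro ⟨hne', ⟨-, hv, huv⟩ | h | h | h | h⟩
          · exact ⟨v, huv, if_pos hv⟩
          · exact absurd (h.1.trans h.2.symm) hne'
          · exact absurd (h.1.trans h.2.symm) hne'
          · exact ⟨b', h.1 ▸ hab', by simp [hr, hb', h.1, h.2, hne.symm]⟩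
          · exact ⟨b, h.1 ▸ hab, by simp [hr, hb, h.1, h.2]⟩
      refine ⟨fun u v => f u (r u v), fun u v => g u (r u v),
        ⟨fun u hu v hv huv => ?_, fun u hu => ?_⟩, ?_⟩
      · simpa only [hr, hu, hv, if_true] using hsS u hu v hv huv
      · refine IsSimultaneousAt.comp (p := f u) (q := g u) ?_ (hrinj u hu)
        rw [himg u hu]
        exact hl u trivial
      · simp [hr, hb, hb', hne.symm, hsf, hsg]
  · have hA : G.Adj a a' := by
      by_contra hA
      have hA' : ¬ G.Adj a' a := fun e => hA e.symm
      refine hcut fun X => hasTwoCutEdges_map hG fun u v u' v' huv huv' hne hu hv => ?_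
      have e1 := h.eq_or_eq u
      have e2 := h.eq_or_eq u'
      have e3 := h.eq_or_eq v
      have e4 := h.eq_or_eq v'
      have := huv.symm
      have := huv'.symm
      simp only [collapseCompl] at hne hu hv
      grind
    push Not at hcut
    obtain ⟨X, ⟨x, hx⟩, ⟨y, hy⟩, hX⟩ := hcut
    have hmem : ∀ x, collapseCompl S a x ∈ S := fun x => by
      simp only [collapseCompl]
      grind
    refine hm.exists_of_inner_cut hG hχ h hA ⟨_, hmem x, hx⟩ ⟨_, hmem y, hy⟩ ?_
    intro u hu v hv u' hu' v' hv' huX hvX huX' hvX' huv huv'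
    by_contra hcon
    exact hX ⟨u, v, u', v', huX, hvX, huX', hvX',
      (hadj u v).2 ⟨huv.ne, Or.inl ⟨hu, hv, huv⟩⟩,
      (hadj u' v').2 ⟨huv'.ne, Or.inl ⟨hu', hv', huv'⟩⟩, not_and_or.1 hcon⟩

end SimultaneousColorableBelow

/-- A counterexample to the strong SE conjecture with the minimum number of edges and,
among those, the maximum number of vertices, has no nontrivial edge cut of size 2: every
edge cut of size 2 separates off a single vertex. -/
theorem extremal_counterexample_no_nontrivial_two_edge_cut
    {V : Type} [Fintype V] (G : SimpleGraph V)
    (hbridgeless : IsKEdgeConnected G 2) (hbip : G.Colorable 2)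
    (hnotSE : ¬ SimultaneousEdgeColorable G 2)
    (hminEdges : ∀ (k : ℕ) (G' : SimpleGraph (Fin k)), IsKEdgeConnected G' 2 →
      G'.Colorable 2 → G'.edgeSet.ncard < G.edgeSet.ncard →
      SimultaneousEdgeColorable G' 2)
    (hmaxVerts : ∀ (k : ℕ) (G' : SimpleGraph (Fin k)), IsKEdgeConnected G' 2 →
      G'.Colorable 2 → G'.edgeSet.ncard = G.edgeSet.ncard → Fintype.card V < k →
      SimultaneousEdgeColorable G' 2)
    : ∀ S : Set V, S.Nonempty → Sᶜ.Nonempty → (cutEdges G S).ncard = 2 →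
      (∃ v : V, S = {v}) ∨ (∃ v : V, Sᶜ = {v}) := by
  intro S hS hSc hcard
  obtain ⟨a, b, a', b', h⟩ := exists_isTwoEdgeCut hcard
  by_contra! hcon
  obtain ⟨hS1, hSc1⟩ := hcon
  obtain ⟨χ⟩ := hbip
  have hχ : ∀ u v, G.Adj u v → χ u ≠ χ v := fun u v huv => χ.valid huv
  have hm : SimultaneousColorableBelow G.edgeSet.ncard := hminEdges
  have hG : ∀ X : Set V, X.Nonempty → Xᶜ.Nonempty → HasTwoCutEdges G X :=
    fun X hX hXc => hbridgeless.hasTwoCutEdges hX hXc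
  refine hnotSE ((simultaneousEdgeColorable_two_iff G).2 ?_)
  have hab := hχ a b h.adj
  have hab' := hχ a' b' h.adj'
  by_cases haa' : χ a = χ a'
  · have hbb' : χ b = χ b' := by omega
    obtain ⟨f, g, hfg, h1, h2⟩ := hm.exists_of_same_side hG hχ h haa' (hSc1 b)
    obtain ⟨f', g', hfg', h1', h2'⟩ :=
      hm.exists_of_same_side hG hχ h.compl hbb' (by simpa using hS1 a)
    exact h.exists_glue_of_perm hfg hfg' (Or.inr ⟨h1, h2, h1', h2'⟩)
  · have hbb' : χ b ≠ χ b' := by omega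
    obtain ⟨f, g, hfg, h1, h2⟩ := hm.exists_of_opposite_side hG hχ h haa'
    obtain ⟨f', g', hfg', h1', h2'⟩ := hm.exists_of_opposite_side hG hχ h.compl hbb'
    exact h.exists_glue_of_perm hfg hfg' (Or.inl ⟨h1, h2, h1', h2'⟩)
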